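/- Let n ≥ 1 and let t be an integer with −n ≤ t ≤ n and n − t even. Let K be a finite nonempty key set, and for each k ∈ K let E_k be a CPTP map from 2^n × 2^n matrices to d' × d' matrices that is invertible by a CPTP map D_k (D_k(E_k(M)) = M for every 2^n×2^n matrix M). Suppose the averaged cipher is (t,ε)-indistinguishable: there exists a density matrix Ω on ℂ^{d'} such that for every d_E ≥ 1 and every density matrix ρ on ℂ^{2^n} ⊗ ℂ^{d_E} for which there exists a density matrix σ on ℂ^{d_E} with ρ ≤ 2^{−t}(I_{2^n} ⊗ σ), one has ‖ (1/|K|) ∑_{k∈K} (E_k ⊗ id)(ρ) − Ω ⊗ tr_A ρ ‖₁ ≤ ε. If ε ≤ 1/2 then |K| ≥ 2^{n−t−1}, i.e., the cipher requires at least n − t − 1 bits of key. -/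

import Mathlib

open Matrix Kronecker ComplexOrder

noncomputable section

/-- A density matrix: positive semidefinite with trace 1. -/
def IsDensity {d : Type*} [Fintype d] (ρ : Matrix d d ℂ) : Prop :=
  ρ.PosSemidef ∧ ρ.trace = 1

/-- Loewner order: `A ≤ B` iff `B - A` is positive semidefinite. -/
def LoewnerLE {d : Type*} [Fintype d] (A B : Matrix d d ℂ) : Prop :=
  (B - A).PosSemidef

/-- Partial trace over the first (A) system. -/
def ptraceA {A E : Type*} [Fintype A] (M : Matrix (A × E) (A × E) ℂ) : Matrix E E ℂ :=
  Matrix.of fun e e' => ∑ a, M (a, e) (a, e')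

/-- Partial trace over the second (E) system. -/
def ptraceE {A E : Type*} [Fintype E] (M : Matrix (A × E) (A × E) ℂ) : Matrix A A ℂ :=
  Matrix.of fun a a' => ∑ e, M (a, e) (a', e)

open scoped MatrixOrder in
/-- Trace norm of a complex matrix: `tr √(MᴴM)`. -/
def traceNorm {d : Type*} [Fintype d] [DecidableEq d] (M : Matrix d d ℂ) : ℝ :=
  (CFC.sqrt (Mᴴ * M)).trace.re

section helpers

variable {d : Type*} [Fintype d] [DecidableEq d]

/-- functional calculus of a Hermitian matrix -/
def hfc {H : Matrix d d ℂ} (hH : H.IsHermitian) (f : ℝ → ℝ) : Matrix d d ℂ :=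
  (hH.eigenvectorUnitary : Matrix d d ℂ) *
    Matrix.diagonal (fun i => ((f (hH.eigenvalues i) : ℝ) : ℂ)) *
    (hH.eigenvectorUnitary : Matrix d d ℂ)ᴴ

lemma hfc_uu {H : Matrix d d ℂ} (hH : H.IsHermitian) :
    (hH.eigenvectorUnitary : Matrix d d ℂ)ᴴ * (hH.eigenvectorUnitary : Matrix d d ℂ) = 1 :=
  Matrix.mem_unitaryGroup_iff'.1 hH.eigenvectorUnitary.2

lemma hfc_uu' {H : Matrix d d ℂ} (hH : H.IsHermitian) :
    (hH.eigenvectorUnitary : Matrix d d ℂ) * (hH.eigenvectorUnitary : Matrix d d ℂ)ᴴ = 1 :=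
  Matrix.mem_unitaryGroup_iff.1 hH.eigenvectorUnitary.2

lemma hfc_mul {H : Matrix d d ℂ} (hH : H.IsHermitian) (f g : ℝ → ℝ) :
    hfc hH f * hfc hH g = hfc hH (fun x => f x * g x) := by
  unfold hfc
  have : ∀ U D₁ D₂ : Matrix d d ℂ, Uᴴ * U = 1 → (U * D₁ * Uᴴ) * (U * D₂ * Uᴴ) =
      U * (D₁ * D₂) * Uᴴ := by
    intro U D₁ D₂ h
    calc _ = U * D₁ * (Uᴴ * U) * D₂ * Uᴴ := by simp only [Matrix.mul_assoc]
      _ = _ := by rw [h]; simp only [Matrix.mul_assoc, Matrix.one_mul]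
  rw [this _ _ _ (hfc_uu hH), Matrix.diagonal_mul_diagonal]
  simp

lemma hfc_sub {H : Matrix d d ℂ} (hH : H.IsHermitian) (f g : ℝ → ℝ) :
    hfc hH f - hfc hH g = hfc hH (fun x => f x - g x) := by
  unfold hfc
  rw [← Matrix.sub_mul, ← Matrix.mul_sub, Matrix.diagonal_sub]
  simp

lemma hfc_add {H : Matrix d d ℂ} (hH : H.IsHermitian) (f g : ℝ → ℝ) :
    hfc hH f + hfc hH g = hfc hH (fun x => f x + g x) := by
  unfold hfc
  rw [← Matrix.add_mul, ← Matrix.mul_add, Matrix.diagonal_add]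
  simp

lemma hfc_one {H : Matrix d d ℂ} (hH : H.IsHermitian) :
    hfc hH (fun _ => 1) = 1 := by
  unfold hfc
  simp [hfc_uu' hH]

lemma hfc_id {H : Matrix d d ℂ} (hH : H.IsHermitian) :
    hfc hH (fun x => x) = H := by
  conv_rhs => rw [hH.spectral_theorem]
  unfold hfc
  rw [Unitary.conjStarAlgAut_apply]
  rfl

lemma hfc_psd {H : Matrix d d ℂ} (hH : H.IsHermitian) (f : ℝ → ℝ)
    (hf : ∀ i, 0 ≤ f (hH.eigenvalues i)) : (hfc hH f).PosSemidef := by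
  unfold hfc
  apply Matrix.PosSemidef.mul_mul_conjTranspose_same
  apply Matrix.PosSemidef.diagonal
  intro i
  simpa using hf i

lemma hfc_congr {H : Matrix d d ℂ} (hH : H.IsHermitian) (f g : ℝ → ℝ)
    (hf : ∀ i, f (hH.eigenvalues i) = g (hH.eigenvalues i)) : hfc hH f = hfc hH g := by
  unfold hfc
  simp [hf]

lemma hfc_herm {H : Matrix d d ℂ} (hH : H.IsHermitian) (f : ℝ → ℝ) :
    (hfc hH f)ᴴ = hfc hH f := by
  unfold hfc
  simp only [Matrix.conjTranspose_mul, Matrix.conjTranspose_conjTranspose,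
    Matrix.diagonal_conjTranspose, Matrix.mul_assoc]
  congr 3
  ext i
  simp

lemma psd_exists {A : Matrix d d ℂ} (hA : A.PosSemidef) :
    ∃ B : Matrix d d ℂ, B.PosSemidef ∧ Bᴴ = B ∧ B * B = A := by
  refine ⟨hfc hA.1 Real.sqrt, hfc_psd _ _ fun i => Real.sqrt_nonneg _, hfc_herm _ _, ?_⟩
  rw [hfc_mul]
  conv_rhs => rw [← hfc_id hA.1]
  exact hfc_congr _ _ _ fun i => Real.mul_self_sqrt (hA.eigenvalues_nonneg i)

/-- square root together with a pseudo-inverse of the root -/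
lemma psd_root_pinv {A : Matrix d d ℂ} (hA : A.PosSemidef) :
    ∃ B P : Matrix d d ℂ, B.PosSemidef ∧ B * B = A ∧ Pᴴ = P ∧ P * A = B ∧
      (1 - P * A * P).PosSemidef := by
  have e : hfc hA.1 (fun x => (Real.sqrt x)⁻¹) * A = hfc hA.1 Real.sqrt := by
    have := hfc_mul hA.1 (fun x => (Real.sqrt x)⁻¹) (fun x => x)
    rw [hfc_id hA.1] at this
    rw [this]
    refine hfc_congr _ _ _ fun i => ?_
    have h := hA.eigenvalues_nonneg i
    rw [inv_mul_eq_div, Real.div_sqrt]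
  refine ⟨hfc hA.1 Real.sqrt, hfc hA.1 (fun x => (Real.sqrt x)⁻¹),
    hfc_psd _ _ fun i => Real.sqrt_nonneg _, ?_, hfc_herm _ _, e, ?_⟩
  · rw [hfc_mul]
    conv_rhs => rw [← hfc_id hA.1]
    exact hfc_congr _ _ _ fun i => Real.mul_self_sqrt (hA.eigenvalues_nonneg i)
  · rw [e, hfc_mul, ← hfc_one hA.1, hfc_sub]
    refine hfc_psd _ _ fun i => ?_
    have := mul_inv_le_one (a := Real.sqrt (hA.1.eigenvalues i))
    linarith

lemma tr_mul_nonneg {A B : Matrix d d ℂ} (hA : A.PosSemidef) (hB : B.PosSemidef) :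
    0 ≤ (A * B).trace.re := by
  obtain ⟨R, -, hR, rfl⟩ := psd_exists hB
  have h : (A * (R * R)).trace = (Rᴴ * A * R).trace := by
    rw [← Matrix.mul_assoc, Matrix.trace_mul_comm, hR, Matrix.mul_assoc]
  rw [h]
  exact (Complex.le_def.1 (hA.conjTranspose_mul_mul_same R).trace_nonneg).1

lemma tr_mul_mono {A B C : Matrix d d ℂ} (h : (B - A).PosSemidef) (hC : C.PosSemidef) :
    (A * C).trace.re ≤ (B * C).trace.re := by
  have := tr_mul_nonneg h hC
  rw [Matrix.sub_mul, Matrix.trace_sub, Complex.sub_re] at this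
  linarith

lemma herm_dec {H : Matrix d d ℂ} (hH : H.IsHermitian) :
    ∃ P N S : Matrix d d ℂ, P.PosSemidef ∧ N.PosSemidef ∧ H = P - N ∧ P * N = 0 ∧ N * P = 0 ∧
      S * H = P + N ∧ H * S = P + N ∧ (1 - S).PosSemidef ∧ (1 + S).PosSemidef := by
  have aux : ∀ x : ℝ, max x 0 - max (-x) 0 = x := by
    intro x; rcases le_total 0 x with h | h <;> simp [h]
  have aux2 : ∀ x : ℝ, max x 0 * max (-x) 0 = 0 := by
    intro x; rcases le_total 0 x with h | h <;> simp [h]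
  have aux3 : ∀ x : ℝ, (if 0 ≤ x then (1 : ℝ) else -1) * x = max x 0 + max (-x) 0 := by
    intro x
    split_ifs with h
    · simp [h]
    · have := (not_le.1 h).le
      simp [this]
  refine ⟨hfc hH (fun x => max x 0), hfc hH (fun x => max (-x) 0),
    hfc hH (fun x => if 0 ≤ x then 1 else -1), hfc_psd _ _ (by simp), hfc_psd _ _ (by simp),
    ?_, ?_, ?_, ?_, ?_, ?_, ?_⟩
  · rw [hfc_sub]
    conv_lhs => rw [← hfc_id hH]
    exact hfc_congr _ _ _ fun i => (aux _).symm
  · rw [hfc_mul]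
    simp only [aux2]
    simp [hfc]
  · rw [hfc_mul]
    simp only [fun x : ℝ => (mul_comm (max (-x) 0) (max x 0)).trans (aux2 x)]
    simp [hfc]
  · rw [hfc_add]
    have := hfc_mul hH (fun x => if 0 ≤ x then 1 else -1) (fun x => x)
    rw [hfc_id hH] at this
    rw [this]
    exact hfc_congr _ _ _ fun i => (aux3 _)
  · rw [hfc_add]
    have := hfc_mul hH (fun x => x) (fun x => if 0 ≤ x then 1 else -1)
    rw [hfc_id hH] at this
    rw [this]
    refine hfc_congr _ _ _ fun i => ?_
    rw [mul_comm]; exact (aux3 _)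
  · rw [← hfc_one hH, hfc_sub]
    refine hfc_psd _ _ fun i => ?_
    split_ifs <;> norm_num
  · rw [← hfc_one hH, hfc_add]
    refine hfc_psd _ _ fun i => ?_
    split_ifs <;> norm_num

open scoped MatrixOrder in
lemma tr_le_traceNorm {M S : Matrix d d ℂ} (hM : M.IsHermitian) (h1 : (1 - S).PosSemidef)
    (h2 : (1 + S).PosSemidef) : (S * M).trace.re ≤ traceNorm M := by
  obtain ⟨P, N, -, hP, hN, hMe, hPN, hNP, -⟩ := herm_dec hM
  have hs : CFC.sqrt (Mᴴ * M) = P + N := by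
    apply CFC.sqrt_unique
    · rw [hM.eq, hMe]
      simp only [Matrix.add_mul, Matrix.mul_add, Matrix.sub_mul, Matrix.mul_sub, hPN, hNP]
      simp
    · exact Matrix.nonneg_iff_posSemidef.2 (hP.add hN)
  unfold traceNorm
  rw [hs, hMe]
  have a := tr_mul_nonneg h1 hP
  have b := tr_mul_nonneg h2 hN
  simp only [Matrix.add_mul, Matrix.mul_sub, Matrix.sub_mul, Matrix.one_mul, Matrix.trace_add,
    Matrix.trace_sub, Complex.add_re, Complex.sub_re] at a b ⊢
  linarith

/-- Powers–Størmer -/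
lemma powers_stormer {A B : Matrix d d ℂ} (hA : A.PosSemidef) (hB : B.PosSemidef) :
    ((A * A).trace.re + (B * B).trace.re) - 2 * (A * B).trace.re ≤ traceNorm (A * A - B * B) := by
  have hH : (A - B).IsHermitian := hA.1.sub hB.1
  obtain ⟨P, N, S, hP, hN, hHe, hPN, hNP, hSH, hHS, h1, h2⟩ := herm_dec hH
  have hM : (A * A - B * B).IsHermitian := by
    unfold Matrix.IsHermitian
    simp [hA.1.eq, hB.1.eq]
  refine le_trans ?_ (tr_le_traceNorm hM h1 h2)
  have e1 : (2 : ℂ) * (S * (A * A - B * B)).trace = 2 * ((P + N) * (A + B)).trace := by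
    have : (2 : ℂ) • (A * A - B * B) = (A - B) * (A + B) + (A + B) * (A - B) := by
      rw [two_smul]; noncomm_ring
    rw [← smul_eq_mul, ← Matrix.trace_smul, ← Matrix.mul_smul, this, Matrix.mul_add,
      Matrix.trace_add, ← Matrix.mul_assoc, hSH, ← Matrix.mul_assoc S,
      Matrix.trace_mul_comm (S * (A + B)), ← Matrix.mul_assoc, hHS]
    ring
  have e2 := mul_left_cancel₀ two_ne_zero e1
  rw [e2]
  have hsq : (A * A).trace + (B * B).trace - 2 * (A * B).trace = ((P - N) * (A - B)).trace := by
    rw [← hHe]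
    simp only [Matrix.mul_sub, Matrix.sub_mul, Matrix.trace_sub, Matrix.trace_mul_comm B A]
    ring
  have hsq' := congrArg Complex.re hsq
  simp only [Complex.add_re, Complex.sub_re, Complex.mul_re, Complex.re_ofNat, Complex.im_ofNat,
    zero_mul, sub_zero] at hsq'
  rw [hsq']
  have a := tr_mul_nonneg hP hB
  have b := tr_mul_nonneg hN hA
  simp only [Matrix.add_mul, Matrix.mul_sub, Matrix.mul_add, Matrix.sub_mul, Matrix.trace_add,
    Matrix.trace_sub, Complex.add_re, Complex.sub_re] at a b ⊢
  linarith

lemma psd_smul_real {A : Matrix d d ℂ} (hA : A.PosSemidef) {c : ℝ} (hc : 0 ≤ c) :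
    ((c : ℂ) • A).PosSemidef := hA.smul (by exact_mod_cast hc)

lemma core {K : Type*} [Fintype K] [Nonempty K] (X Y : Matrix d d ℂ) (ρ T : K → Matrix d d ℂ)
    (q : ℝ) (hρ : ∀ k, (ρ k).PosSemidef) (hρ1 : ∀ k, (ρ k).trace = 1)
    (hX : X = (Fintype.card K : ℂ)⁻¹ • ∑ k, ρ k)
    (hY : Y.PosSemidef) (hY1 : Y.trace = 1) (hT : ∀ k, (T k).PosSemidef)
    (hT1 : ∀ k, (1 - T k).PosSemidef) (hTρ : ∀ k, (T k * ρ k).trace = 1)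
    (hTY : ∀ k, (T k * Y).trace.re ≤ q) (hXY : traceNorm (X - Y) ≤ 1 / 2) :
    1 / 2 ≤ (Fintype.card K : ℝ) * q := by
  set κ : ℝ := (Fintype.card K : ℝ) with hκ
  have hκ0 : 0 < κ := by rw [hκ]; exact_mod_cast Fintype.card_pos
  have hκc : ((Fintype.card K : ℂ)) = (κ : ℂ) := by simp [hκ]
  rw [hκc] at hX
  have hκc0 : (κ : ℂ) ≠ 0 := by exact_mod_cast hκ0.ne'
  have hXκ : ∑ k, ρ k = (κ : ℂ) • X := by rw [hX, smul_smul, mul_inv_cancel₀ hκc0, one_smul]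
  have hsum : (∑ k, ρ k).PosSemidef := Matrix.posSemidef_sum _ fun k _ => hρ k
  have hXp : X.PosSemidef := by
    rw [hX, ← Complex.ofReal_inv]
    exact psd_smul_real hsum (inv_nonneg.2 hκ0.le)
  have hX1 : X.trace = 1 := by
    rw [hX, Matrix.trace_smul, Matrix.trace_sum]
    simp only [hρ1, Finset.sum_const, Finset.card_univ, nsmul_eq_mul, mul_one, hκc, smul_eq_mul]
    exact inv_mul_cancel₀ hκc0
  obtain ⟨A, P, hA, hAA, hPh, hPX, hPP⟩ := psd_root_pinv hXp
  obtain ⟨B, hB, hBh, hBB⟩ := psd_exists hY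
  have hps := powers_stormer hA hB
  rw [hAA, hBB, hX1, hY1] at hps
  simp only [Complex.one_re] at hps
  have h34 : 3 / 4 ≤ (B * A).trace.re := by
    rw [Matrix.trace_mul_comm]; linarith
  -- per-key bound
  have key : ∀ k, (B * P * ρ k).trace.re ≤ κ * q + 1 / 4 := by
    intro k
    obtain ⟨R, hR, hRh, hRR⟩ := psd_exists (hρ k)
    obtain ⟨G, hG, hGh, hGG⟩ := psd_exists (hT1 k)
    have hTh : (T k)ᴴ = T k := (hT k).1.eq
    have hGR : G * R = 0 := by
      rw [← Matrix.trace_conjTranspose_mul_self_eq_zero_iff, Matrix.conjTranspose_mul, hGh, hRh]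
      calc (R * G * (G * R)).trace = (R * (G * G * R)).trace := by simp only [Matrix.mul_assoc]
        _ = ((G * G) * (R * R)).trace := by rw [Matrix.trace_mul_comm]; simp only [Matrix.mul_assoc]
        _ = 0 := by
          rw [hGG, hRR, Matrix.sub_mul, Matrix.trace_sub, hTρ, Matrix.one_mul, hρ1, sub_self]
    have hTR : T k * R = R := by
      have : (1 - T k) * R = 0 := by rw [← hGG, Matrix.mul_assoc, hGR, Matrix.mul_zero]
      rw [Matrix.sub_mul, Matrix.one_mul, sub_eq_zero] at this
      exact this.symm
    have hRT : R * T k = R := by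
      have := congrArg Matrix.conjTranspose hTR
      rwa [Matrix.conjTranspose_mul, hTh, hRh] at this
    set C := T k * B with hC
    set L := P * R with hL
    have hLL : ((κ : ℂ) • (1 : Matrix d d ℂ) - L * Lᴴ).PosSemidef := by
      have h1 : ((κ : ℂ) • X - ρ k).PosSemidef := by
        rw [← hXκ]
        classical
        rw [← Finset.add_sum_erase _ _ (Finset.mem_univ k), add_sub_cancel_left]
        exact Matrix.posSemidef_sum _ fun k _ => hρ k
      have h2 := (h1.mul_mul_conjTranspose_same P).add (psd_smul_real hPP hκ0.le)
      convert h2 using 1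
      rw [hPh, hL, Matrix.conjTranspose_mul, hPh, hRh]
      have : P * R * (R * P) = P * ρ k * P := by rw [← hRR]; simp only [Matrix.mul_assoc]
      rw [this]
      simp only [Matrix.mul_sub, Matrix.sub_mul, smul_sub, Matrix.mul_smul, Matrix.smul_mul]
      abel
    have hCC : (Cᴴ * C).trace.re ≤ q := by
      refine le_trans ?_ (hTY k)
      have hTT : (T k - T k * T k).PosSemidef := by
        have := ((hT1 k).conjTranspose_mul_mul_same (T k)).add
          ((hT k).conjTranspose_mul_mul_same (1 - T k))
        convert this using 1
        rw [(hT1 k).1.eq, hTh]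
        noncomm_ring
      have h := tr_mul_mono hTT hY
      refine le_trans (le_of_eq ?_) h
      rw [hC, Matrix.conjTranspose_mul, hTh, hBh, ← hBB]
      congr 1
      rw [Matrix.mul_assoc, Matrix.trace_mul_comm]
      simp only [Matrix.mul_assoc]
    have hq : ((C * L) * (C * L)ᴴ).trace.re ≤ κ * q := by
      have h := tr_mul_mono hLL (Matrix.posSemidef_conjTranspose_mul_self C)
      have e : ((C * L) * (C * L)ᴴ).trace = (L * Lᴴ * (Cᴴ * C)).trace := by
        rw [Matrix.conjTranspose_mul, Matrix.mul_assoc, Matrix.trace_mul_comm]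
        simp only [Matrix.mul_assoc]
      rw [e]
      refine h.trans ?_
      rw [Matrix.smul_mul, Matrix.one_mul, Matrix.trace_smul, smul_eq_mul, Complex.re_ofReal_mul]
      exact mul_le_mul_of_nonneg_left hCC hκ0.le
    have e0 : (B * P * ρ k).trace = (C * L * R).trace := by
      rw [hC, hL]
      calc (B * P * ρ k).trace = ((B * P * R) * (R * T k)).trace := by
            rw [hRT, ← hRR]; simp only [Matrix.mul_assoc]
        _ = (T k * B * (P * R) * R).trace := by
            rw [← Matrix.mul_assoc, Matrix.trace_mul_comm]; simp only [Matrix.mul_assoc]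
    have hnn := (Complex.le_def.1 (Matrix.posSemidef_self_mul_conjTranspose
      ((2 : ℂ) • (C * L) - R)).trace_nonneg).1
    have e3 : (R * (C * L)ᴴ).trace = star (C * L * R).trace := by
      rw [← Matrix.trace_conjTranspose, Matrix.conjTranspose_mul (C * L) R, hRh]
    rw [Matrix.conjTranspose_sub, Matrix.conjTranspose_smul, hRh] at hnn
    simp only [Matrix.mul_sub, Matrix.sub_mul, Matrix.mul_smul, Matrix.smul_mul, Matrix.trace_sub,
      Matrix.trace_smul, e3, hRR, hρ1] at hnn
    rw [e0]
    rw [Matrix.conjTranspose_mul] at hq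
    simp at hnn
    linarith
  have hs : (B * A).trace.re * κ = ∑ k, (B * P * ρ k).trace.re := by
    rw [← Complex.re_sum, ← Matrix.trace_sum, ← Finset.mul_sum, hXκ, Matrix.mul_smul,
      Matrix.mul_assoc, hPX, Matrix.trace_smul, smul_eq_mul, Complex.re_ofReal_mul, mul_comm]
  have hle : ∑ k, (B * P * ρ k).trace.re ≤ ∑ _k : K, (κ * q + 1 / 4) :=
    Finset.sum_le_sum fun k _ => key k
  rw [← hs, Finset.sum_const, Finset.card_univ, nsmul_eq_mul, ← hκ, mul_comm] at hle
  have := le_of_mul_le_mul_left hle hκ0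
  linarith

end helpers
section tensor

set_option linter.unusedSectionVars false

variable {a b e : Type*} [Fintype a] [Fintype b] [Fintype e] [DecidableEq a] [DecidableEq b]
  [DecidableEq e]

lemma kron_conj_apply (B : Matrix b a ℂ) (M : Matrix (a × e) (a × e) ℂ) (p q : b × e) :
    ((B ⊗ₖ (1 : Matrix e e ℂ)) * M * (B ⊗ₖ (1 : Matrix e e ℂ))ᴴ) p q =
      (B * (Matrix.of fun x y => M (x, p.2) (y, q.2)) * Bᴴ) p.1 q.1 := by
  simp only [Matrix.mul_apply, Matrix.conjTranspose_apply, Matrix.kroneckerMap_apply,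
    Fintype.sum_prod_type, Matrix.one_apply, Matrix.of_apply]
  refine Finset.sum_congr rfl fun x _ => ?_
  simp [apply_ite, Finset.sum_ite_eq]

lemma kron_sum_gram {J : Type*} [Fintype J] (N : J → Matrix b a ℂ)
    (hN : ∑ j, (N j)ᴴ * N j = 1) :
    ∑ j, (N j ⊗ₖ (1 : Matrix e e ℂ))ᴴ * (N j ⊗ₖ (1 : Matrix e e ℂ)) = 1 := by
  have : ∀ j, (N j ⊗ₖ (1 : Matrix e e ℂ))ᴴ * (N j ⊗ₖ (1 : Matrix e e ℂ)) =
      ((N j)ᴴ * N j) ⊗ₖ (1 : Matrix e e ℂ) := by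
    intro j
    rw [Matrix.conjTranspose_kronecker, ← Matrix.mul_kronecker_mul]
    simp
  simp only [this]
  have h2 : ∑ j, ((N j)ᴴ * N j) ⊗ₖ (1 : Matrix e e ℂ) =
      (∑ j, (N j)ᴴ * N j) ⊗ₖ (1 : Matrix e e ℂ) := by
    ext p q
    simp [Matrix.sum_apply, Matrix.kroneckerMap_apply, Finset.sum_mul]
  rw [h2, hN, Matrix.one_kronecker_one]

lemma kron_inv {J J' : Type*} [Fintype J] [Fintype J'] (N : J → Matrix b a ℂ)
    (D : J' → Matrix a b ℂ)
    (hinv : ∀ M : Matrix a a ℂ, ∑ j', D j' * (∑ j, N j * M * (N j)ᴴ) * (D j')ᴴ = M)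
    (M : Matrix (a × e) (a × e) ℂ) :
    ∑ j', (D j' ⊗ₖ (1 : Matrix e e ℂ)) * (∑ j, (N j ⊗ₖ (1 : Matrix e e ℂ)) * M *
      (N j ⊗ₖ (1 : Matrix e e ℂ))ᴴ) * (D j' ⊗ₖ (1 : Matrix e e ℂ))ᴴ = M := by
  ext p q
  rw [Matrix.sum_apply]
  simp only [kron_conj_apply]
  have h := congrFun (congrFun (hinv (Matrix.of fun x y => M (x, p.2) (y, q.2))) p.1) q.1
  rw [Matrix.sum_apply] at h
  simp only [Matrix.of_apply] at h
  rw [← h]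
  refine Finset.sum_congr rfl fun j' _ => ?_
  have h3 : (Matrix.of fun x y => (∑ j, (N j ⊗ₖ (1 : Matrix e e ℂ)) * M *
      (N j ⊗ₖ (1 : Matrix e e ℂ))ᴴ) (x, p.2) (y, q.2)) =
      ∑ j, N j * (Matrix.of fun x y => M (x, p.2) (y, q.2)) * (N j)ᴴ := by
    ext x y
    simp only [Matrix.of_apply, Matrix.sum_apply, kron_conj_apply]
  rw [h3]

lemma tr_kraus {x y : Type*} [Fintype x] [Fintype y] [DecidableEq x] {J : Type*} [Fintype J]
    (F : J → Matrix y x ℂ) (Q : Matrix y y ℂ) (M : Matrix x x ℂ) :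
    ((∑ j, (F j)ᴴ * Q * F j) * M).trace = (Q * ∑ j, F j * M * (F j)ᴴ).trace := by
  rw [Finset.sum_mul, Finset.mul_sum, Matrix.trace_sum, Matrix.trace_sum]
  refine Finset.sum_congr rfl fun j _ => ?_
  rw [Matrix.mul_assoc, Matrix.mul_assoc, Matrix.trace_mul_comm]
  simp only [Matrix.mul_assoc]

lemma tr_kraus_one {x y : Type*} [Fintype x] [Fintype y] [DecidableEq x] [DecidableEq y]
    {J : Type*} [Fintype J]
    (F : J → Matrix y x ℂ) (hF : ∑ j, (F j)ᴴ * F j = 1) (M : Matrix x x ℂ) :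
    (∑ j, F j * M * (F j)ᴴ).trace = M.trace := by
  have := tr_kraus F 1 M
  simp only [Matrix.mul_one, Matrix.one_mul, hF] at this
  exact this.symm

lemma tr_mul_kron_one (Q : Matrix (a × e) (a × e) ℂ) (c : ℂ) (hQ : ptraceE Q = c • 1)
    (W : Matrix a a ℂ) : (Q * (W ⊗ₖ (1 : Matrix e e ℂ))).trace = c * W.trace := by
  have h1 : (Q * (W ⊗ₖ (1 : Matrix e e ℂ))).trace = (ptraceE Q * W).trace := by
    simp only [Matrix.trace, Matrix.diag_apply, Matrix.mul_apply, Fintype.sum_prod_type,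
      Matrix.kroneckerMap_apply, Matrix.one_apply, ptraceE, Matrix.of_apply, Finset.sum_mul]
    refine Finset.sum_congr rfl fun x _ => ?_
    rw [Finset.sum_comm]
    refine Finset.sum_congr rfl fun y _ => ?_
    simp [Finset.sum_ite_eq]
  rw [h1, hQ, Matrix.smul_mul, Matrix.one_mul, Matrix.trace_smul, smul_eq_mul]

/-- the isometry (up to scaling) defining the test projector -/
def tw {m : Type*} [DecidableEq m] (f : a ≃ e × m) : Matrix (a × e) m ℂ :=
  Matrix.of fun p x => if f p.1 = (p.2, x) then 1 else 0

lemma tw_gram {m : Type*} [Fintype m] [DecidableEq m] (f : a ≃ e × m) :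
    (tw f)ᴴ * tw f = (Fintype.card e : ℂ) • 1 := by
  ext x y
  simp only [Matrix.mul_apply, Matrix.conjTranspose_apply, tw, Matrix.of_apply,
    Fintype.sum_prod_type, Matrix.smul_apply, Matrix.one_apply]
  rw [← Equiv.sum_comp f.symm, Fintype.sum_prod_type]
  by_cases h : x = y
  · subst h
    simp [Prod.ext_iff, ite_and]
  · simp [Prod.ext_iff, ite_and, h]
    exact fun h' => absurd h'.symm h

lemma tw_ptraceE {m : Type*} [Fintype m] [DecidableEq m] (f : a ≃ e × m) :
    ptraceE (tw f * (tw f)ᴴ) = 1 := by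
  ext x y
  simp only [ptraceE, Matrix.mul_apply, Matrix.conjTranspose_apply, tw, Matrix.of_apply,
    Matrix.one_apply]
  rw [← Fintype.sum_prod_type (fun z : e × m => (if f x = (z.1, z.2) then (1:ℂ) else 0) *
    star (if f y = (z.1, z.2) then (1:ℂ) else 0))]
  simp [apply_ite, eq_comm]

lemma tw_ptraceA {m : Type*} [Fintype m] [DecidableEq m] (f : a ≃ e × m) :
    ptraceA (tw f * (tw f)ᴴ) = (Fintype.card m : ℂ) • 1 := by
  ext x y
  simp only [ptraceA, Matrix.mul_apply, Matrix.conjTranspose_apply, tw, Matrix.of_apply,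
    Matrix.one_apply, Matrix.smul_apply]
  rw [← Equiv.sum_comp f.symm, Fintype.sum_prod_type]
  by_cases h : x = y
  · subst h
    simp [Prod.ext_iff, ite_and]
  · simp [Prod.ext_iff, ite_and, h, Ne.symm h]

end tensor
/-- any cipher (a family of CPTP maps `E_k`, each invertible by a
CPTP map) that is `(t,ε)`-indistinguishable — i.e. there is a density `Ω` such
that for every `d_E ≥ 1` and every density `ρ` on `ℂ^{2^n} ⊗ ℂ^{d_E}` with
`ρ ≤ 2^{-t}(I ⊗ σ)` for some density `σ`, one has
`‖(1/|K|) ∑_k (E_k ⊗ id)(ρ) - Ω ⊗ tr_A ρ‖₁ ≤ ε` — must use at least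
`n - t - 1` bits of key when `ε ≤ 1/2`: `|K| ≥ 2^{n-t-1}`. -/
theorem entropic_cipher_key_lower_bound {n d' : ℕ} (hn : 1 ≤ n)
    (t : ℤ) (ht1 : -(n : ℤ) ≤ t) (ht2 : t ≤ (n : ℤ)) (hpar : Even ((n : ℤ) - t))
    {K : Type*} [Fintype K] [Nonempty K]
    {J : Type*} [Fintype J]
    (N : K → J → Matrix (Fin d') (Fin (2 ^ n)) ℂ)
    (hN : ∀ k, ∑ j, (N k j)ᴴ * N k j = 1)
    {J' : Type*} [Fintype J']
    (D : K → J' → Matrix (Fin (2 ^ n)) (Fin d') ℂ)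
    (hD : ∀ k, ∑ j', (D k j')ᴴ * D k j' = 1)
    (hinv : ∀ k, ∀ M : Matrix (Fin (2 ^ n)) (Fin (2 ^ n)) ℂ,
      ∑ j', D k j' * (∑ j, N k j * M * (N k j)ᴴ) * (D k j')ᴴ = M)
    (ε : ℝ) (hε : 0 ≤ ε)
    (Ω : Matrix (Fin d') (Fin d') ℂ) (hΩ : IsDensity Ω)
    (hsec : ∀ dE : ℕ, 1 ≤ dE →
      ∀ ρ : Matrix (Fin (2 ^ n) × Fin dE) (Fin (2 ^ n) × Fin dE) ℂ, IsDensity ρ →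
      (∃ σ : Matrix (Fin dE) (Fin dE) ℂ, IsDensity σ ∧
        LoewnerLE ρ ((((2 : ℝ) ^ (-(t : ℝ)) : ℝ) : ℂ) •
          ((1 : Matrix (Fin (2 ^ n)) (Fin (2 ^ n)) ℂ) ⊗ₖ σ))) →
      traceNorm
          ((Fintype.card K : ℂ)⁻¹ • ∑ k, ∑ j,
              (N k j ⊗ₖ (1 : Matrix (Fin dE) (Fin dE) ℂ)) * ρ *
                (N k j ⊗ₖ (1 : Matrix (Fin dE) (Fin dE) ℂ))ᴴ
            - Ω ⊗ₖ ptraceA ρ)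
        ≤ ε)
    (hε2 : ε ≤ 1 / 2) :
    (2 : ℝ) ^ ((n : ℝ) - (t : ℝ) - 1) ≤ (Fintype.card K : ℝ) := by
  classical
  obtain ⟨r, hr⟩ := hpar
  obtain ⟨s, rfl⟩ : ∃ s : ℕ, r = s := ⟨r.toNat, by omega⟩
  obtain ⟨u, hu⟩ : ∃ u : ℕ, (n : ℤ) = s + u := ⟨((n : ℤ) - s).toNat, by omega⟩
  have htu : t = u - s := by omega
  have hnu : n = s + u := by omega
  let f : Fin (2 ^ n) ≃ Fin (2 ^ s) × Fin (2 ^ u) :=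
    (finCongr (by rw [hnu, pow_add])).trans finProdFinEquiv.symm
  set α : ℝ := 2 ^ s with hα
  set μ : ℝ := 2 ^ u with hμ
  have hα0 : 0 < α := by positivity
  have hμ0 : 0 < μ := by positivity
  have hαc : (α : ℂ) ≠ 0 := by exact_mod_cast hα0.ne'
  have hμc : (μ : ℂ) ≠ 0 := by exact_mod_cast hμ0.ne'
  have hcα : ((Fintype.card (Fin (2 ^ s)) : ℕ) : ℂ) = (α : ℂ) := by simp [hα]
  have hcμ : ((Fintype.card (Fin (2 ^ u)) : ℕ) : ℂ) = (μ : ℂ) := by simp [hμ]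
  have hgram := tw_gram f
  have hpE := tw_ptraceE f
  have hpA := tw_ptraceA f
  rw [hcα] at hgram
  rw [hcμ] at hpA
  set V := tw f with hV
  have hVp : (V * Vᴴ).PosSemidef := Matrix.posSemidef_self_mul_conjTranspose V
  set Q : Matrix (Fin (2 ^ n) × Fin (2 ^ s)) (Fin (2 ^ n) × Fin (2 ^ s)) ℂ :=
    ((α⁻¹ : ℝ) : ℂ) • (V * Vᴴ) with hQ
  have hQp : Q.PosSemidef := psd_smul_real hVp (inv_nonneg.2 hα0.le)
  have hQQ : Q * Q = Q := by
    have : V * Vᴴ * (V * Vᴴ) = (α : ℂ) • (V * Vᴴ) := by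
      calc V * Vᴴ * (V * Vᴴ) = V * (Vᴴ * V) * Vᴴ := by simp only [Matrix.mul_assoc]
        _ = _ := by rw [hgram]; simp
    rw [hQ, Matrix.smul_mul, Matrix.mul_smul, this, smul_smul, smul_smul]
    congr 1
    push_cast
    field_simp
  have hQ1 : (1 - Q).PosSemidef := by
    have h := Matrix.posSemidef_conjTranspose_mul_self (1 - Q)
    have e : (1 - Q)ᴴ * (1 - Q) = 1 - Q := by
      rw [Matrix.conjTranspose_sub, hQp.1.eq, Matrix.conjTranspose_one]
      simp [Matrix.mul_sub, Matrix.sub_mul, hQQ]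
    rwa [e] at h
  have hQtr : Q.trace = (μ : ℂ) := by
    rw [hQ, Matrix.trace_smul, Matrix.trace_mul_comm, hgram, Matrix.trace_smul, Matrix.trace_one,
      hcμ]
    simp only [smul_eq_mul]
    push_cast
    field_simp
  have hQE : ptraceE Q = ((α⁻¹ : ℝ) : ℂ) • 1 := by
    rw [← hpE, hQ]
    ext x y
    simp [ptraceE, Finset.mul_sum]
  set ρ := ((μ⁻¹ : ℝ) : ℂ) • Q with hρ
  have hρp : ρ.PosSemidef := psd_smul_real hQp (inv_nonneg.2 hμ0.le)
  have hρ1 : ρ.trace = 1 := by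
    rw [hρ, Matrix.trace_smul, hQtr, smul_eq_mul]
    push_cast
    field_simp
  have hρA : ptraceA ρ = ((α⁻¹ : ℝ) : ℂ) • 1 := by
    have : ptraceA ρ = (((μ⁻¹ : ℝ) : ℂ) * ((α⁻¹ : ℝ) : ℂ)) • ptraceA (V * Vᴴ) := by
      rw [hρ, hQ]
      ext x y
      simp [ptraceA, Finset.mul_sum, mul_assoc]
    rw [this, hpA, smul_smul]
    congr 1
    push_cast
    field_simp
  have htt : (2 : ℝ) ^ (-(t : ℝ)) = α * μ⁻¹ := by
    rw [htu, hα, hμ]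
    push_cast
    rw [neg_sub, Real.rpow_sub two_pos, Real.rpow_natCast, Real.rpow_natCast, div_eq_mul_inv]
  have hsec1 := hsec (2 ^ s) Nat.one_le_two_pow ρ ⟨hρp, hρ1⟩
    ⟨((α⁻¹ : ℝ) : ℂ) • 1, ⟨psd_smul_real Matrix.PosSemidef.one (inv_nonneg.2 hα0.le), by
      rw [Matrix.trace_smul, Matrix.trace_one, hcα, smul_eq_mul]
      push_cast
      field_simp⟩, by
      unfold LoewnerLE
      convert psd_smul_real hQ1 (inv_nonneg.2 hμ0.le) using 1
      rw [htt, Matrix.kronecker_smul, Matrix.one_kronecker_one, smul_smul, smul_sub, hρ]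
      congr 2
      push_cast
      field_simp⟩
  rw [hρA] at hsec1
  have hN' := fun k => kron_sum_gram (e := Fin (2 ^ s)) (N k) (hN k)
  have hD' := fun k => kron_sum_gram (e := Fin (2 ^ s)) (D k) (hD k)
  have hfin := core _ (Ω ⊗ₖ (((α⁻¹ : ℝ) : ℂ) • (1 : Matrix (Fin (2 ^ s)) (Fin (2 ^ s)) ℂ)))
    (fun k => ∑ j, (N k j ⊗ₖ (1 : Matrix (Fin (2 ^ s)) (Fin (2 ^ s)) ℂ)) * ρ *
                (N k j ⊗ₖ (1 : Matrix (Fin (2 ^ s)) (Fin (2 ^ s)) ℂ))ᴴ)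
    (fun k => ∑ j, (D k j ⊗ₖ (1 : Matrix (Fin (2 ^ s)) (Fin (2 ^ s)) ℂ))ᴴ * Q *
                (D k j ⊗ₖ (1 : Matrix (Fin (2 ^ s)) (Fin (2 ^ s)) ℂ)))
    (α⁻¹ * α⁻¹)
    (fun k => Matrix.posSemidef_sum _ fun j _ => hρp.mul_mul_conjTranspose_same _)
    (fun k => by rw [tr_kraus_one _ (hN' k), hρ1]) rfl
    (hΩ.1.kronecker (psd_smul_real Matrix.PosSemidef.one (inv_nonneg.2 hα0.le)))
    (by
      rw [Matrix.trace_kronecker, hΩ.2, Matrix.trace_smul, Matrix.trace_one, hcα, smul_eq_mul]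
      push_cast
      field_simp)
    (fun k => Matrix.posSemidef_sum _ fun j _ => hQp.conjTranspose_mul_mul_same _)
    (fun k => by
      have h : (∑ j, (D k j ⊗ₖ (1 : Matrix (Fin (2 ^ s)) (Fin (2 ^ s)) ℂ))ᴴ * (1 - Q) *
                (D k j ⊗ₖ (1 : Matrix (Fin (2 ^ s)) (Fin (2 ^ s)) ℂ))).PosSemidef :=
        Matrix.posSemidef_sum _ fun j _ => hQ1.conjTranspose_mul_mul_same _
      convert h using 1
      simp only [Matrix.mul_sub, Matrix.sub_mul, Matrix.mul_one, Finset.sum_sub_distrib]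
      rw [hD' k])
    (fun k => by
      rw [tr_kraus, kron_inv (N k) (D k) (hinv k), hρ, Matrix.mul_smul, hQQ, ← hρ, hρ1])
    (fun k => by
      rw [Matrix.kronecker_smul, Matrix.mul_smul, Matrix.trace_smul, tr_kraus]
      have h : ∑ j, (D k j ⊗ₖ (1 : Matrix (Fin (2 ^ s)) (Fin (2 ^ s)) ℂ)) *
          (Ω ⊗ₖ (1 : Matrix (Fin (2 ^ s)) (Fin (2 ^ s)) ℂ)) *
          (D k j ⊗ₖ (1 : Matrix (Fin (2 ^ s)) (Fin (2 ^ s)) ℂ))ᴴ =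
          (∑ j, D k j * Ω * (D k j)ᴴ) ⊗ₖ (1 : Matrix (Fin (2 ^ s)) (Fin (2 ^ s)) ℂ) := by
        ext p q
        simp only [Matrix.conjTranspose_kronecker, ← Matrix.mul_kronecker_mul]
        simp [Matrix.sum_apply, Matrix.kroneckerMap_apply, Finset.sum_mul]
      rw [h, tr_mul_kron_one Q _ hQE, tr_kraus_one _ (hD k), hΩ.2, mul_one, smul_eq_mul,
        ← Complex.ofReal_mul, Complex.ofReal_re])
    (hsec1.trans hε2)
  have hgoal : (2 : ℝ) ^ ((n : ℝ) - (t : ℝ) - 1) = α * α / 2 := by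
    rw [htu, hnu, hα]
    push_cast
    have : ((s : ℝ) + u - (u - s) - 1) = ((s + s : ℕ) : ℝ) - 1 := by push_cast; ring
    rw [this, Real.rpow_sub two_pos, Real.rpow_natCast, pow_add, Real.rpow_one]
  rw [hgoal]
  have h2 : (Fintype.card K : ℝ) = ((Fintype.card K : ℝ) * (α⁻¹ * α⁻¹)) * (α * α) := by
    field_simp
  rw [h2]
  have := mul_le_mul_of_nonneg_right hfin (mul_pos hα0 hα0).le
  linarith
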